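/- arXiv:2205.03473 — 2 statements merged into one kernel-verified Lean document; each statement's English description precedes it below -/
import Mathlib

section
/- Let (Ω, P) be a probability space, let v* ∈ ℝ and ς, ϑ > 0, and let V, A : Ω → ℝ be random variables such that the pushforward of P under ω ↦ (V(ω), A(ω)) equals the product measure (gaussianReal v* ς²) ⊗ (gaussianReal 0 ϑ²). Then ∫_Ω V(ω) · max(A(ω), 0) dP(ω) = v* · ϑ / √(2π). -/
open MeasureTheory ProbabilityTheory

lemma half_gauss (ϑ : ℝ) (hϑ : 0 < ϑ) :
    ∫ x, max x 0 ∂(gaussianReal 0 ((ϑ ^ 2).toNNReal)) = ϑ / Real.sqrt (2 * Real.pi) := by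
  have hv : (ϑ ^ 2).toNNReal ≠ 0 := by
    simp only [ne_eq, Real.toNNReal_eq_zero, not_le]; positivity
  have hc : (((ϑ ^ 2).toNNReal : NNReal) : ℝ) = ϑ ^ 2 := Real.coe_toNNReal _ (by positivity)
  rw [integral_gaussianReal_eq_integral_smul hv]
  have h1 : (fun x : ℝ => gaussianPDFReal 0 ((ϑ ^ 2).toNNReal) x • max x 0) =
      Set.indicator (Set.Ioi 0) (fun x : ℝ => (Real.sqrt (2 * Real.pi * ϑ ^ 2))⁻¹ *
        (x ^ (1 : ℝ) * Real.exp (-(1 / (2 * ϑ ^ 2)) * x ^ (2 : ℝ)))) := by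
    funext x
    by_cases hx : 0 < x
    · rw [Set.indicator_of_mem (by exact hx), max_eq_left hx.le, gaussianPDFReal, hc,
        Real.rpow_one, Real.rpow_two, smul_eq_mul, sub_zero]
      have : -x ^ 2 / (2 * ϑ ^ 2) = -(1 / (2 * ϑ ^ 2)) * x ^ 2 := by ring
      rw [this]; ring
    · rw [Set.indicator_of_notMem (by exact hx), max_eq_right (not_lt.mp hx), smul_zero]
  rw [h1, integral_indicator measurableSet_Ioi, integral_const_mul,
    integral_rpow_mul_exp_neg_mul_rpow (by norm_num) (by norm_num) (by positivity)]
  have h2 : (-(1 + 1) / 2 : ℝ) = -1 := by norm_num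
  have h3 : ((1 + 1) / 2 : ℝ) = 1 := by norm_num
  rw [h2, h3, Real.Gamma_one, Real.rpow_neg_one, Real.sqrt_mul (by positivity),
    Real.sqrt_sq hϑ.le]
  have : Real.sqrt (2 * Real.pi) ≠ 0 := by positivity
  field_simp

/-- Pointwise-in-time core of Theorem 3: if speed `V ~ N(v*, ς²)` and acceleration
`A ~ N(0, ϑ²)` are independent (joint law is the product of the Gaussians), then the
expected instantaneous power per unit mass is `E[V · max(A, 0)] = v* ϑ / √(2π)`. -/
theorem expected_power_of_gaussian
    {Ω : Type*} [MeasurableSpace Ω] (P : Measure Ω) [IsProbabilityMeasure P]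
    (vstar ς ϑ : ℝ) (hς : 0 < ς) (hϑ : 0 < ϑ)
    (V A : Ω → ℝ)
    (hmap : P.map (fun ω => (V ω, A ω)) =
      (gaussianReal vstar ((ς ^ 2).toNNReal)).prod (gaussianReal 0 ((ϑ ^ 2).toNNReal))) :
    ∫ ω, V ω * max (A ω) 0 ∂P = vstar * ϑ / Real.sqrt (2 * Real.pi) := by
  have hm : AEMeasurable (fun ω => (V ω, A ω)) P := by
    by_contra h
    rw [Measure.map_of_not_aemeasurable h] at hmap
    exact IsProbabilityMeasure.ne_zero _ hmap.symm
  have hf : Continuous (fun z : ℝ × ℝ => z.1 * max z.2 0) := by fun_prop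
  have := integral_map hm (f := fun z : ℝ × ℝ => z.1 * max z.2 0) hf.aestronglyMeasurable
  rw [← this, hmap, integral_prod_mul (fun x : ℝ => x) (fun y : ℝ => max y 0),
    integral_id_gaussianReal, half_gauss ϑ hϑ]
  ring
end

section
/- Let α > 0, κ > 0, σ > 0 be reals, and suppose ω̲, ω̄ are reals with 0 < ω̲ < ω̄ < π/(2σ) and ακ = ω̲² cos(ω̲σ) = ω̄² cos(ω̄σ). Let B ∈ ℝ satisfy ω̲ sin(ω̲σ) < B < ω̄ sin(ω̄σ). Then every s ∈ ℂ with s² e^{sσ} + B·s + ακ = 0 has negative real part. -/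
open Real in
lemma g_anti {u v : ℝ} (hu : 0 ≤ u) (huv : u < v) (hv : v < π / 2) :
    2 * cos v - v * sin v < 2 * cos u - u * sin u := by
  have h1 : cos v < cos u := cos_lt_cos_of_nonneg_of_le_pi_div_two hu hv.le huv
  have h2 : sin u ≤ sin v := (sin_lt_sin_of_lt_of_le_pi_div_two (by linarith) hv.le huv).le
  have h3 : 0 ≤ sin u := sin_nonneg_of_nonneg_of_le_pi hu (by linarith)
  nlinarith [mul_le_mul huv.le h2 h3 (by linarith)]

open Real in
lemma f_der (t : ℝ) : HasDerivAt (fun t : ℝ => t ^ 2 * cos t) (t * (2 * cos t - t * sin t)) t := by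
  have := (hasDerivAt_pow 2 t).mul (hasDerivAt_cos t)
  refine this.congr_deriv ?_
  simp; ring

open Real in
lemma f_inc {u v : ℝ} (hu : 0 ≤ u) (huv : u < v) (hv : v < π / 2)
    (hg : 0 ≤ 2 * cos v - v * sin v) : u ^ 2 * cos u < v ^ 2 * cos v := by
  have h : StrictMonoOn (fun t : ℝ => t ^ 2 * cos t) (Set.Icc u v) := by
    apply strictMonoOn_of_deriv_pos (convex_Icc u v) (by fun_prop)
    intro t ht
    rw [interior_Icc] at ht
    rw [(f_der t).deriv]
    exact mul_pos (by linarith [ht.1]) (by linarith [g_anti (by linarith [ht.1]) ht.2 hv])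
  exact h ⟨le_rfl, huv.le⟩ ⟨huv.le, le_rfl⟩ huv

open Real in
lemma f_dec {u v : ℝ} (hu : 0 ≤ u) (huv : u < v) (hv : v < π / 2)
    (hg : 2 * cos u - u * sin u ≤ 0) : v ^ 2 * cos v < u ^ 2 * cos u := by
  have h : StrictAntiOn (fun t : ℝ => t ^ 2 * cos t) (Set.Icc u v) := by
    apply strictAntiOn_of_deriv_neg (convex_Icc u v) (by fun_prop)
    intro t ht
    rw [interior_Icc] at ht
    rw [(f_der t).deriv]
    exact mul_neg_of_pos_of_neg (by linarith [ht.1])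
      (by linarith [g_anti hu ht.1 (by linarith [ht.2])])
  exact h ⟨le_rfl, huv.le⟩ ⟨huv.le, le_rfl⟩ huv

open Real in
set_option maxHeartbeats 1000000 in
lemma core (A B a b x y : ℝ) (ha : 0 < a) (hab : a < b) (hb : b < π / 2)
    (hA : A = a ^ 2 * cos a) (hA' : A = b ^ 2 * cos b)
    (hBl : a * sin a < B) (hBu : B < b * sin b) (hx : 0 ≤ x) (hy : 0 < y)
    (h1 : exp x * ((x ^ 2 - y ^ 2) * cos y - 2 * x * y * sin y) + B * x + A = 0)
    (h2 : exp x * ((x ^ 2 - y ^ 2) * sin y + 2 * x * y * cos y) + B * y = 0) : False := by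
  have hsa : 0 < sin a := sin_pos_of_pos_of_lt_pi ha (by linarith)
  have hca : 0 < cos a := cos_pos_of_mem_Ioo ⟨by linarith, by linarith⟩
  have hcb : 0 < cos b := cos_pos_of_mem_Ioo ⟨by linarith, by linarith⟩
  have hsb : 0 < sin b := sin_pos_of_pos_of_lt_pi (by linarith) (by linarith)
  have hA0 : 0 < A := by rw [hA]; positivity
  have hB0 : 0 < B := lt_trans (by positivity) hBl
  have hex : 1 ≤ exp x := one_le_exp hx
  rcases le_or_gt b y with hby | hyb
  · -- modulus argument
    set r := x ^ 2 + y ^ 2 with hr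
    have hb0 : 0 < b := by linarith
    have hmod : B ^ 2 * r + 2 * A * B * x + A ^ 2 = exp (2 * x) * r ^ 2 := by
      have e : exp (2 * x) = exp x ^ 2 := by rw [← exp_nat_mul]; norm_num
      have e1 : B * x + A = -(exp x * ((x ^ 2 - y ^ 2) * cos y - 2 * x * y * sin y)) := by linarith
      have e2 : B * y = -(exp x * ((x ^ 2 - y ^ 2) * sin y + 2 * x * y * cos y)) := by linarith
      have : B ^ 2 * r + 2 * A * B * x + A ^ 2 = (B * x + A) ^ 2 + (B * y) ^ 2 := by rw [hr]; ring
      rw [this, e1, e2, e, hr]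
      have hs : sin y ^ 2 = 1 - cos y ^ 2 := sin_sq y
      ring_nf
      have h4 : sin y ^ 2 = 1 - cos y ^ 2 := sin_sq y
      rw [h4]; ring
    have hrb : b ^ 2 ≤ r := by
      have := pow_le_pow_left₀ hb0.le hby 2
      linarith [sq_nonneg x]
    set C := b * sin b with hC
    have hC0 : 0 < C := by positivity
    have hb4 : C ^ 2 * b ^ 2 + A ^ 2 = b ^ 4 := by
      rw [hA', hC]; linear_combination b ^ 4 * sin_sq_add_cos_sq b
    have hE : 1 + 2 * x ≤ exp (2 * x) := by linarith [add_one_le_exp (2 * x)]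
    have hr0 : 0 < r := by positivity
    have k1 : B ^ 2 * r < C ^ 2 * r := by
      apply mul_lt_mul_of_pos_right _ hr0
      exact pow_lt_pow_left₀ hBu hB0.le (by norm_num)
    have k2 : A * B * x ≤ A * C * x := by gcongr
    have k3 : (1 + 2 * x) * r ^ 2 ≤ exp (2 * x) * r ^ 2 := by gcongr
    have hCb : C ^ 2 ≤ b ^ 2 * 1 := by
      rw [hC, mul_pow]; gcongr; nlinarith [sin_sq_add_cos_sq b, sq_nonneg (cos b)]
    have k4 : C ^ 2 * r + A ^ 2 ≤ r ^ 2 := by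
      -- r^2 - C^2 r - A^2 = (r-b^2)(r+b^2-C^2)
      have : C ^ 2 ≤ b ^ 2 := by linarith
      have h5 : r ^ 2 - C ^ 2 * r - A ^ 2 = (r - b ^ 2) * (r + b ^ 2 - C ^ 2) := by
        linear_combination -hb4
      have := mul_nonneg (sub_nonneg.2 hrb) (by linarith : 0 ≤ r + b ^ 2 - C ^ 2)
      linarith
    have k5 : A * C ≤ r ^ 2 := by
      have q1 : A ≤ b ^ 2 := by
        rw [hA']; exact mul_le_of_le_one_right (sq_nonneg b) (cos_le_one b)
      have q2 : C ≤ b ^ 2 := by rw [hC, sq]; exact mul_le_mul_of_nonneg_left (sin_lt hb0).le hb0.le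
      rw [sq r]
      exact mul_le_mul (q1.trans hrb) (q2.trans hrb) hC0.le hr0.le
    linarith [mul_le_mul_of_nonneg_right k5 hx]
  · have hsy : 0 < sin y := sin_pos_of_pos_of_lt_pi hy (by linarith)
    have hcy : 0 < cos y := cos_pos_of_mem_Ioo ⟨by linarith, by linarith⟩
    rcases le_or_gt y a with hya | hay
    · have ga : 0 ≤ 2 * cos a - a * sin a := by
        by_contra h
        have := f_dec ha.le hab hb (by linarith)
        linarith
      have gy : 0 ≤ 2 * cos y - y * sin y := by
        rcases hya.lt_or_eq with h | h
        · linarith [g_anti hy.le h (by linarith)]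
        · rw [h]; exact ga
      have hss : y * sin y ≤ a * sin a := by
        have : sin y ≤ sin a := sin_le_sin_of_le_of_le_pi_div_two (by linarith) (by linarith) hya
        exact mul_le_mul hya this hsy.le ha.le
      have e1 : exp x * (1 - x) ≤ 1 := by
        have := add_one_le_exp (-x)
        have h6 : exp x * exp (-x) = 1 := by rw [← exp_add]; simp
        nlinarith [exp_pos x]
      have k : (y ^ 2 - x ^ 2) * sin y - 2 * x * y * cos y ≤ (y ^ 2 * sin y) * (1 - x) := by
        nlinarith [mul_nonneg (mul_nonneg hx hy.le) gy, mul_nonneg (sq_nonneg x) hsy.le]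
      have k2 := mul_le_mul_of_nonneg_left k (exp_pos x).le
      have k3 := mul_le_mul_of_nonneg_left e1 (by positivity : 0 ≤ y ^ 2 * sin y)
      have k4 : y * B ≤ y * (y * sin y) := by nlinarith
      have := le_of_mul_le_mul_left k4 hy
      linarith
    · have hf : A < y ^ 2 * cos y := by
        rcases le_total 0 (2 * cos y - y * sin y) with h | h
        · rw [hA]; exact f_inc ha.le hay (by linarith) h
        · rw [hA']; exact f_dec hy.le hyb hb h
      have e : A * y = exp x * ((x ^ 2 + y ^ 2) * (x * sin y + y * cos y)) := by
        linear_combination y * h1 - x * h2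
      have k : y ^ 2 * (y * cos y) ≤ (x ^ 2 + y ^ 2) * (x * sin y + y * cos y) := by
        gcongr
        · nlinarith
        · nlinarith [mul_nonneg hx hsy.le]
      have k2 : 1 * (y ^ 2 * (y * cos y)) ≤ exp x * ((x ^ 2 + y ^ 2) * (x * sin y + y * cos y)) := by
        gcongr
      nlinarith

/-- Plant stability condition (equation (15) of the paper): if
`ακ = ω̲² cos(ω̲σ) = ω̄² cos(ω̄σ)` with `0 < ω̲ < ω̄ < π/(2σ)` and
`ω̲ sin(ω̲σ) < B < ω̄ sin(ω̄σ)`, then all roots of the characteristic equation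
`s² e^{sσ} + B s + ακ = 0` have negative real parts. -/
theorem plant_stability
    (α κ σ : ℝ) (hα : 0 < α) (hκ : 0 < κ) (hσ : 0 < σ)
    (ωl ωu : ℝ) (hωl : 0 < ωl) (hlu : ωl < ωu) (hup : ωu < Real.pi / (2 * σ))
    (hl : α * κ = ωl ^ 2 * Real.cos (ωl * σ))
    (hu : α * κ = ωu ^ 2 * Real.cos (ωu * σ))
    (B : ℝ) (hBl : ωl * Real.sin (ωl * σ) < B) (hBu : B < ωu * Real.sin (ωu * σ)) :
    ∀ s : ℂ, s ^ 2 * Complex.exp (s * σ) + (B : ℂ) * s + (α : ℂ) * κ = 0 → s.re < 0 := by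
  intro s hs
  by_contra hneg
  push Not at hneg
  have hb : ωu * σ < Real.pi / 2 := by
    rw [lt_div_iff₀ (by positivity)] at hup
    linarith
  have ha : 0 < ωl * σ := by positivity
  have hB0 : 0 < B := by
    refine lt_trans (mul_pos hωl (Real.sin_pos_of_pos_of_lt_pi ha ?_)) hBl
    nlinarith [Real.pi_pos]
  have hre := congrArg Complex.re hs
  have him := congrArg Complex.im hs
  simp [sq, Complex.exp_re, Complex.exp_im] at hre him
  set x := s.re
  set y := s.im
  have key : ∀ y' : ℝ, 0 < y' → 
      Real.exp (x * σ) * ((x ^ 2 - y' ^ 2) * Real.cos (y' * σ) - 2 * x * y' * Real.sin (y' * σ)) + B * x + α * κ = 0 →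
      Real.exp (x * σ) * ((x ^ 2 - y' ^ 2) * Real.sin (y' * σ) + 2 * x * y' * Real.cos (y' * σ)) + B * y' = 0 → False := by
    intro y' hy' e1 e2
    refine core (α * κ * σ ^ 2) (B * σ) (ωl * σ) (ωu * σ) (x * σ) (y' * σ) ha
      (by gcongr) hb (by rw [hl]; ring) (by rw [hu]; ring) (by nlinarith) (by nlinarith)
      (by positivity) (by positivity) ?_ ?_
    · linear_combination σ ^ 2 * e1
    · linear_combination σ ^ 2 * e2
  rcases lt_trichotomy y 0 with h | h | h
  · apply key (-y) (by linarith)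
    · simp only [neg_mul, Real.cos_neg, Real.sin_neg]
      linear_combination hre
    · simp only [neg_mul, Real.cos_neg, Real.sin_neg]
      linear_combination -him
  · rw [h] at hre
    simp at hre
    have : 0 < α * κ := by positivity
    have h2 : 0 ≤ B * x := by positivity
    have h3 : 0 ≤ x * x * Real.exp (x * σ) := mul_nonneg (mul_self_nonneg x) (Real.exp_pos _).le
    linarith
  · apply key y h
    · linear_combination hre
    · linear_combination him
end
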